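/- arXiv:2007.12095 — 11 statements merged into one kernel-verified Lean document; each statement's English description precedes it below -/
import Mathlib

section
/- Let k be a commutative ring, Ω a nonempty set, λ : Ω → k a family of weights, R a k-algebra, and (P_ω)_{ω∈Ω} a family of k-linear operators on R making (R, (P_ω)) a matching Rota-Baxter algebra of weight λ. For any finitely supported family of scalars (a_ω)_{ω∈Ω} in k, the linear combination P := Σ_{ω∈Ω} a_ω P_ω is a Rota-Baxter operator on R of weight Σ_{ω∈Ω} a_ω λ_ω; that is, P(x)P(y) = P(xP(y)) + P(P(x)y) + (Σ_ω a_ω λ_ω) P(xy) for all x, y ∈ R. -/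
/-- A finitely supported linear combination of the operators of a matching Rota-Baxter
algebra of weight `lam` is a Rota-Baxter operator of weight `∑ ω, a ω * lam ω`. -/
theorem matching_rb_linear_combination
    (k : Type*) [CommRing k] (Ω : Type*) [Nonempty Ω] (lam : Ω → k)
    (R : Type*) [Ring R] [Algebra k R] (P : Ω → R →ₗ[k] R)
    (hP : ∀ (α β : Ω) (x y : R),
      P α x * P β y = P α (x * P β y) + P β (P α x * y) + lam β • P α (x * y))
    (a : Ω →₀ k) (x y : R) :
    (∑ ω ∈ a.support, a ω • P ω x) * (∑ ω ∈ a.support, a ω • P ω y) =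
      (∑ ω ∈ a.support, a ω • P ω (x * ∑ ω' ∈ a.support, a ω' • P ω' y)) +
      (∑ ω ∈ a.support, a ω • P ω ((∑ ω' ∈ a.support, a ω' • P ω' x) * y)) +
      (∑ ω ∈ a.support, a ω * lam ω) • (∑ ω ∈ a.support, a ω • P ω (x * y)) := by
  have h2 : (∑ ω ∈ a.support, a ω • P ω ((∑ ω' ∈ a.support, a ω' • P ω' x) * y)) =
      ∑ α ∈ a.support, ∑ β ∈ a.support, (a α * a β) • P β (P α x * y) := by
    rw [Finset.sum_comm]
    refine Finset.sum_congr rfl fun β _ => ?_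
    rw [Finset.sum_mul, map_sum, Finset.smul_sum]
    refine Finset.sum_congr rfl fun α _ => ?_
    rw [smul_mul_assoc, map_smul, smul_smul, mul_comm]
  have h1 : (∑ ω ∈ a.support, a ω • P ω (x * ∑ ω' ∈ a.support, a ω' • P ω' y)) =
      ∑ α ∈ a.support, ∑ β ∈ a.support, (a α * a β) • P α (x * P β y) := by
    refine Finset.sum_congr rfl fun α _ => ?_
    rw [Finset.mul_sum, map_sum, Finset.smul_sum]
    refine Finset.sum_congr rfl fun β _ => ?_
    rw [mul_smul_comm, map_smul, smul_smul]
  have h3 : (∑ ω ∈ a.support, a ω * lam ω) • (∑ ω ∈ a.support, a ω • P ω (x * y)) =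
      ∑ α ∈ a.support, ∑ β ∈ a.support, (a α * a β) • lam β • P α (x * y) := by
    rw [Finset.smul_sum]
    refine Finset.sum_congr rfl fun α _ => ?_
    rw [Finset.sum_smul]
    refine Finset.sum_congr rfl fun β _ => ?_
    rw [smul_smul, smul_smul]
    congr 1
    ring
  rw [h1, h2, h3, Finset.sum_mul_sum, ← Finset.sum_add_distrib, ← Finset.sum_add_distrib]
  refine Finset.sum_congr rfl fun α _ => ?_
  rw [← Finset.sum_add_distrib, ← Finset.sum_add_distrib]
  refine Finset.sum_congr rfl fun β _ => ?_
  rw [smul_mul_smul_comm, hP, smul_add, smul_add]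
end

section
/- Let k be a commutative ring, Ω a nonempty set, λ : Ω → k, and (R, (P_ω)_{ω∈Ω}) a matching Rota-Baxter k-algebra of weight λ. Define binary operations x ∗_ω y := P_ω(x)y − yP_ω(x) − λ_ω yx for ω ∈ Ω. Then these operations satisfy the matching pre-Lie identity: for all x, y, z ∈ R and α, β ∈ Ω, (x ∗_α y) ∗_β z − x ∗_α (y ∗_β z) = (y ∗_β x) ∗_α z − y ∗_β (x ∗_α z). -/
/-- A matching Rota-Baxter algebra of weight `lam` gives rise to a matching pre-Lie algebra
via `x ∗_ω y := P_ω(x) y - y P_ω(x) - lam ω • (y x)`. -/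
theorem matching_rb_to_matching_preLie
    (k : Type*) [CommRing k] (Ω : Type*) [Nonempty Ω] (lam : Ω → k)
    (R : Type*) [Ring R] [Algebra k R] (P : Ω → R →ₗ[k] R)
    (hP : ∀ (α β : Ω) (x y : R),
      P α x * P β y = P α (x * P β y) + P β (P α x * y) + lam β • P α (x * y))
    (star : Ω → R → R → R)
    (hstar : ∀ (ω : Ω) (x y : R), star ω x y = P ω x * y - y * P ω x - lam ω • (y * x))
    (α β : Ω) (x y z : R) :
    star β (star α x y) z - star α x (star β y z) =
      star α (star β y x) z - star β y (star α x z) := by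
  have key : P β (star α x y) =
      P α (star β y x) + (P α x * P β y - P β y * P α x) := by
    rw [hP α β x y, hP β α y x, hstar, hstar]
    simp only [map_sub, map_smul]
    abel
  rw [hstar β (star α x y) z, hstar α (star β y x) z, key]
  simp only [hstar, mul_sub, sub_mul, mul_add, add_mul, smul_sub, smul_add, mul_smul_comm,
    smul_mul_assoc, mul_assoc]
  rw [smul_comm (lam β) (lam α) (z * (y * x)), smul_comm (lam β) (lam α) (z * (x * y))]
  abel
end

section
/- Let k be a commutative ring, Ω a nonempty set, and A a commutative k-algebra. Then there exists a free commutative matching Rota-Baxter algebra of weight zero on A; that is, there exist a commutative k-algebra F, a family (P_ω)_{ω∈Ω} of k-linear operators on F satisfying P_α(x)P_β(y) = P_α(x P_β(y)) + P_β(P_α(x) y) for all x, y ∈ F and α, β ∈ Ω, and a k-algebra homomorphism j : A → F, such that for every commutative k-algebra R equipped with a family (Q_ω)_{ω∈Ω} of k-linear operators satisfying the same weight-zero matching Rota-Baxter equation and every k-algebra homomorphism f : A → R, there is a unique k-algebra homomorphism f̄ : F → R with f̄ ∘ P_ω = Q_ω ∘ f̄ for all ω ∈ Ω and f̄ ∘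 j = f. -/
universe u v w x

/-- A commutative matching Rota-Baxter algebra of weight zero over `k` with operator
set `Ω`. -/
structure CommMatchingRB (k : Type u) [CommRing k] (Ω : Type v) :
    Type (max u v (w + 1)) where
  carrier : Type w
  [instCommRing : CommRing carrier]
  [instAlgebra : Algebra k carrier]
  P : Ω → carrier →ₗ[k] carrier
  rb : ∀ (α β : Ω) (a b : carrier),
    P α a * P β b = P α (a * P β b) + P β (P α a * b)

attribute [instance] CommMatchingRB.instCommRing CommMatchingRB.instAlgebra

namespace FreeMRB

/-- Formal expressions. -/
inductive Term (k : Type u) (Ω : Type v) (A : Type w) : Type (max u v w) where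
  | scal : k → Term k Ω A
  | of : A → Term k Ω A
  | add : Term k Ω A → Term k Ω A → Term k Ω A
  | mul : Term k Ω A → Term k Ω A → Term k Ω A
  | neg : Term k Ω A → Term k Ω A
  | op : Ω → Term k Ω A → Term k Ω A

open Term

/-- The congruence generated by the axioms. -/
inductive Rel (k : Type u) [CommRing k] (Ω : Type v) (A : Type w) [CommRing A] [Algebra k A] :
    Term k Ω A → Term k Ω A → Prop where
  | refl (s) : Rel k Ω A s s
  | symm {s t} : Rel k Ω A s t → Rel k Ω A t s
  | trans {s t r} : Rel k Ω A s t → Rel k Ω A t r → Rel k Ω A s r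
  | add_congr {s s' t t'} : Rel k Ω A s s' → Rel k Ω A t t' → Rel k Ω A (add s t) (add s' t')
  | mul_congr {s s' t t'} : Rel k Ω A s s' → Rel k Ω A t t' → Rel k Ω A (mul s t) (mul s' t')
  | neg_congr {s s'} : Rel k Ω A s s' → Rel k Ω A (neg s) (neg s')
  | op_congr (ω) {s s'} : Rel k Ω A s s' → Rel k Ω A (op ω s) (op ω s')
  | scal_of (c) : Rel k Ω A (scal c) (of (algebraMap k A c))
  | of_add (a b) : Rel k Ω A (of (a + b)) (add (of a) (of b))
  | of_mul (a b) : Rel k Ω A (of (a * b)) (mul (of a) (of b))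
  | add_assoc (s t r) : Rel k Ω A (add (add s t) r) (add s (add t r))
  | add_comm (s t) : Rel k Ω A (add s t) (add t s)
  | zero_add (s) : Rel k Ω A (add (of 0) s) s
  | neg_add (s) : Rel k Ω A (add (neg s) s) (of 0)
  | mul_assoc (s t r) : Rel k Ω A (mul (mul s t) r) (mul s (mul t r))
  | mul_comm (s t) : Rel k Ω A (mul s t) (mul t s)
  | one_mul (s) : Rel k Ω A (mul (of 1) s) s
  | mul_add (s t r) : Rel k Ω A (mul s (add t r)) (add (mul s t) (mul s r))
  | op_add (ω s t) : Rel k Ω A (op ω (add s t)) (add (op ω s) (op ω t))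
  | op_smul (ω c s) : Rel k Ω A (op ω (mul (scal c) s)) (mul (scal c) (op ω s))
  | rb (α β s t) : Rel k Ω A (mul (op α s) (op β t))
      (add (op α (mul s (op β t))) (op β (mul (op α s) t)))

section
variable (k : Type u) [CommRing k] (Ω : Type v) (A : Type w) [CommRing A] [Algebra k A]

/-- The setoid of the congruence. -/
def S : Setoid (Term k Ω A) := ⟨Rel k Ω A, Rel.refl, Rel.symm, Rel.trans⟩

/-- The free object. -/
def Q : Type (max u v w) := Quotient (S k Ω A)

variable {k Ω A}

/-- The projection. -/
def mk (s : Term k Ω A) : Q k Ω A := Quotient.mk (S k Ω A) s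

theorem sound {s t : Term k Ω A} (h : Rel k Ω A s t) : mk s = mk t := Quotient.sound (s := S k Ω A) h

theorem ind {p : Q k Ω A → Prop} (h : ∀ s, p (mk s)) (x) : p x := Quotient.ind h x

instance : Zero (Q k Ω A) := ⟨mk (of 0)⟩
instance : One (Q k Ω A) := ⟨mk (of 1)⟩
instance : Add (Q k Ω A) := ⟨Quotient.map₂ add fun _ _ h _ _ h' => Rel.add_congr h h'⟩
instance : Mul (Q k Ω A) := ⟨Quotient.map₂ mul fun _ _ h _ _ h' => Rel.mul_congr h h'⟩
instance : Neg (Q k Ω A) := ⟨Quotient.map neg fun _ _ h => Rel.neg_congr h⟩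

/-- The operators on the quotient. -/
def opQ (ω : Ω) : Q k Ω A → Q k Ω A := Quotient.map (op ω) fun _ _ h => Rel.op_congr ω h

theorem q_add_comm (x y : Q k Ω A) : x + y = y + x := by
  induction x using ind; induction y using ind; exact sound (.add_comm _ _)
theorem q_mul_comm (x y : Q k Ω A) : x * y = y * x := by
  induction x using ind; induction y using ind; exact sound (.mul_comm _ _)
theorem q_zero_add (x : Q k Ω A) : 0 + x = x := by
  induction x using ind; exact sound (.zero_add _)
theorem q_one_mul (x : Q k Ω A) : 1 * x = x := by
  induction x using ind; exact sound (.one_mul _)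
theorem q_mul_add (x y z : Q k Ω A) : x * (y + z) = x * y + x * z := by
  induction x using ind; induction y using ind; induction z using ind
  exact sound (.mul_add _ _ _)
theorem q_neg_add (x : Q k Ω A) : -x + x = 0 := by
  induction x using ind; exact sound (.neg_add _)
theorem q_add_assoc (x y z : Q k Ω A) : x + y + z = x + (y + z) := by
  induction x using ind; induction y using ind; induction z using ind
  exact sound (.add_assoc _ _ _)
theorem q_mul_assoc (x y z : Q k Ω A) : x * y * z = x * (y * z) := by
  induction x using ind; induction y using ind; induction z using ind
  exact sound (.mul_assoc _ _ _)

instance : AddCommGroup (Q k Ω A) where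
  add_assoc := q_add_assoc
  zero_add := q_zero_add
  add_zero x := by rw [q_add_comm, q_zero_add]
  neg_add_cancel := q_neg_add
  add_comm := q_add_comm
  nsmul := nsmulRec
  zsmul := zsmulRec

theorem q_zero_mul (x : Q k Ω A) : 0 * x = 0 := by
  have h := q_mul_add x 0 0
  rw [add_zero] at h
  rw [q_mul_comm]
  exact left_eq_add.mp h

instance : CommRing (Q k Ω A) where
  __ := (inferInstance : AddCommGroup (Q k Ω A))
  mul_assoc := q_mul_assoc
  one_mul := q_one_mul
  mul_one x := by rw [q_mul_comm, q_one_mul]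
  left_distrib := q_mul_add
  right_distrib x y z := by rw [q_mul_comm, q_mul_add, q_mul_comm z x, q_mul_comm z y]
  zero_mul := q_zero_mul
  mul_zero x := by rw [q_mul_comm, q_zero_mul]
  mul_comm := q_mul_comm

variable (k Ω A) in
/-- The inclusion as a ring homomorphism. -/
def ofHom : A →+* Q k Ω A where
  toFun a := mk (of a)
  map_one' := rfl
  map_zero' := rfl
  map_add' a b := sound (.of_add a b)
  map_mul' a b := sound (.of_mul a b)

instance : Algebra k (Q k Ω A) := ((ofHom k Ω A).comp (algebraMap k A)).toAlgebra

theorem algebraMap_eq (c : k) : algebraMap k (Q k Ω A) c = mk (scal c) :=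
  (sound (.scal_of c)).symm

variable (k Ω A) in
/-- The inclusion. -/
def j : A →ₐ[k] Q k Ω A := { ofHom k Ω A with commutes' := fun _ => rfl }

variable (k Ω A) in
/-- The free matching Rota-Baxter algebra. -/
def F : CommMatchingRB.{u, v, max u v w} k Ω where
  carrier := Q k Ω A
  P ω :=
    { toFun := opQ ω
      map_add' := fun x y => by
        induction x using ind; induction y using ind; exact sound (.op_add _ _ _)
      map_smul' := fun c x => by
        rw [RingHom.id_apply, Algebra.smul_def, Algebra.smul_def, algebraMap_eq]
        induction x using ind; exact sound (.op_smul _ _ _) }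
  rb α β x y := by
    induction x using ind; induction y using ind; exact sound (.rb _ _ _ _)

variable (R : CommMatchingRB.{u, v, x} k Ω) (f : A →ₐ[k] R.carrier)

/-- Evaluation of formal expressions. -/
def eval : Term k Ω A → R.carrier
  | scal c => algebraMap k R.carrier c
  | of a => f a
  | add s t => eval s + eval t
  | mul s t => eval s * eval t
  | neg s => -eval s
  | op ω s => R.P ω (eval s)

theorem eval_rel {s t : Term k Ω A} (h : Rel k Ω A s t) : eval R f s = eval R f t := by
  induction h with
  | refl => rfl
  | symm _ ih => exact ih.symm
  | trans _ _ ih ih' => exact ih.trans ih'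
  | rb α β s t => exact R.rb _ _ _ _
  | op_smul ω c s => simp only [eval, ← Algebra.smul_def, map_smul]
  | mul_comm s t => exact _root_.mul_comm _ _
  | add_comm s t => exact _root_.add_comm _ _
  | mul_add s t => exact _root_.mul_add _ _ _
  | mul_assoc s t => exact _root_.mul_assoc _ _ _
  | add_assoc s t => exact _root_.add_assoc _ _ _
  | _ => simp_all [eval]

/-- The induced homomorphism. -/
def lift : Q k Ω A →ₐ[k] R.carrier where
  toFun := Quotient.lift (eval R f) fun _ _ h => eval_rel R f h
  map_one' := map_one f
  map_zero' := map_zero f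
  map_add' x y := by induction x using ind; induction y using ind; rfl
  map_mul' x y := by induction x using ind; induction y using ind; rfl
  commutes' c := f.commutes c

theorem lift_unique (g : Q k Ω A →ₐ[k] R.carrier)
    (h1 : ∀ (ω : Ω) (z : Q k Ω A), g (opQ ω z) = R.P ω (g z))
    (h2 : ∀ a : A, g (j k Ω A a) = f a) (s : Term k Ω A) : g (mk s) = eval R f s := by
  induction s with
  | scal c => rw [← algebraMap_eq, g.commutes]; rfl
  | of a => exact h2 a
  | add s t hs ht => exact (map_add g (mk s) (mk t)).trans (by rw [hs, ht]; rfl)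
  | mul s t hs ht => exact (map_mul g (mk s) (mk t)).trans (by rw [hs, ht]; rfl)
  | neg s hs => exact (map_neg g (mk s)).trans (by rw [hs]; rfl)
  | op ω s hs => exact (h1 ω (mk s)).trans (by rw [hs]; rfl)

end

end FreeMRB

/-- Existence of the free commutative matching Rota-Baxter algebra of weight zero on a
commutative algebra `A`. -/
theorem free_comm_matching_rb_on_algebra
    (k : Type u) [CommRing k] (Ω : Type v) [Nonempty Ω]
    (A : Type w) [CommRing A] [Algebra k A] :
    ∃ (F : CommMatchingRB.{u, v, max u v w} k Ω) (j : A →ₐ[k] F.carrier),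
      ∀ (R : CommMatchingRB.{u, v, x} k Ω) (f : A →ₐ[k] R.carrier),
        ∃! g : F.carrier →ₐ[k] R.carrier,
          (∀ (ω : Ω) (z : F.carrier), g (F.P ω z) = R.P ω (g z)) ∧
          ∀ a : A, g (j a) = f a := by
  refine ⟨FreeMRB.F k Ω A, FreeMRB.j k Ω A, fun R f => ⟨FreeMRB.lift R f, ⟨?_, ?_⟩, ?_⟩⟩
  · intro ω z
    exact FreeMRB.ind (p := fun z => FreeMRB.lift R f (FreeMRB.opQ ω z) =
      R.P ω (FreeMRB.lift R f z)) (fun _ => rfl) z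
  · intro a
    rfl
  · rintro g ⟨h1, h2⟩
    refine AlgHom.ext fun z => ?_
    exact FreeMRB.ind (p := fun z => (show FreeMRB.Q k Ω A →ₐ[k] R.carrier from g) z =
      FreeMRB.lift R f z) (fun s => FreeMRB.lift_unique R f g h1 h2 s) z
end

section
/- Let k be a commutative ring, Ω a nonempty set, and X a set. Then there exists a free commutative matching Rota-Baxter algebra of weight zero on the set X; that is, there exist a commutative k-algebra F, a family (P_ω)_{ω∈Ω} of k-linear operators on F satisfying P_α(x)P_β(y) = P_α(x P_β(y)) + P_β(P_α(x) y) for all x, y ∈ F and α, β ∈ Ω, and a map j : X → F, such that for every commutative k-algebra R equipped with a family (Q_ω)_{ω∈Ω} of k-linear operators satisfying the same weight-zero matching Rota-Baxter equation and every set map f : X → R, there is a unique k-algebra homomorphism f̄ : F → R with f̄ ∘ P_ω = Q_ω ∘ f̄ for all ω ∈ Ω and f̄ ∘ j = f. -/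
universe u v w x

namespace FreeRB

/-- Formal terms. -/
inductive Pre (k : Type u) (Ω : Type v) (X : Type w) : Type (max u v w) where
  | var : X → Pre k Ω X
  | const : k → Pre k Ω X
  | plus : Pre k Ω X → Pre k Ω X → Pre k Ω X
  | times : Pre k Ω X → Pre k Ω X → Pre k Ω X
  | op : Ω → Pre k Ω X → Pre k Ω X

open Pre

/-- The congruence generated by the axioms. -/
inductive Rel (k : Type u) [CommRing k] (Ω : Type v) (X : Type w) :
    Pre k Ω X → Pre k Ω X → Prop where
  | refl (a) : Rel k Ω X a a
  | symm {a b} : Rel k Ω X a b → Rel k Ω X b a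
  | trans {a b c} : Rel k Ω X a b → Rel k Ω X b c → Rel k Ω X a c
  | plus_congr {a b c d} : Rel k Ω X a b → Rel k Ω X c d → Rel k Ω X (plus a c) (plus b d)
  | times_congr {a b c d} : Rel k Ω X a b → Rel k Ω X c d → Rel k Ω X (times a c) (times b d)
  | op_congr (o) {a b} : Rel k Ω X a b → Rel k Ω X (op o a) (op o b)
  | const_plus (r s) : Rel k Ω X (const (r + s)) (plus (const r) (const s))
  | const_times (r s) : Rel k Ω X (const (r * s)) (times (const r) (const s))
  | plus_assoc (a b c) : Rel k Ω X (plus (plus a b) c) (plus a (plus b c))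
  | plus_comm (a b) : Rel k Ω X (plus a b) (plus b a)
  | zero_plus (a) : Rel k Ω X (plus (const 0) a) a
  | times_assoc (a b c) : Rel k Ω X (times (times a b) c) (times a (times b c))
  | times_comm (a b) : Rel k Ω X (times a b) (times b a)
  | one_times (a) : Rel k Ω X (times (const 1) a) a
  | distrib (a b c) : Rel k Ω X (times a (plus b c)) (plus (times a b) (times a c))
  | zero_times (a) : Rel k Ω X (times (const 0) a) (const 0)
  | neg_plus (a) : Rel k Ω X (plus (times (const (-1)) a) a) (const 0)
  | op_plus (o a b) : Rel k Ω X (op o (plus a b)) (plus (op o a) (op o b))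
  | op_smul (o r a) : Rel k Ω X (op o (times (const r) a)) (times (const r) (op o a))
  | rb (o p a b) : Rel k Ω X (times (op o a) (op p b))
      (plus (op o (times a (op p b))) (op p (times (op o a) b)))

/-- The setoid of the congruence. -/
def std (k : Type u) [CommRing k] (Ω : Type v) (X : Type w) : Setoid (Pre k Ω X) :=
  ⟨Rel k Ω X, Rel.refl, Rel.symm, Rel.trans⟩

/-- The carrier of the free object. -/
def Free (k : Type u) [CommRing k] (Ω : Type v) (X : Type w) : Type (max u v w) :=
  Quotient (std k Ω X)

section
variable {k : Type u} [CommRing k] {Ω : Type v} {X : Type w}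

/-- The class of a term. -/
def mk (a : Pre k Ω X) : Free k Ω X := Quotient.mk (std k Ω X) a

theorem sound {a b : Pre k Ω X} (h : Rel k Ω X a b) : mk a = mk b :=
  Quotient.sound (s := std k Ω X) h

theorem ind {p : Free k Ω X → Prop} (h : ∀ a, p (mk a)) (z : Free k Ω X) : p z :=
  Quotient.ind (s := std k Ω X) h z

instance : Add (Free k Ω X) :=
  ⟨Quotient.map₂ plus fun _ _ h _ _ h' => Rel.plus_congr h h'⟩
instance : Mul (Free k Ω X) :=
  ⟨Quotient.map₂ times fun _ _ h _ _ h' => Rel.times_congr h h'⟩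
instance : Zero (Free k Ω X) := ⟨mk (const 0)⟩
instance : One (Free k Ω X) := ⟨mk (const 1)⟩
instance : Neg (Free k Ω X) := ⟨fun a => mk (const (-1)) * a⟩

theorem times_comm' (a b : Free k Ω X) : a * b = b * a := by
  revert a b
  refine ind fun a => ind fun b => ?_
  exact sound (Rel.times_comm a b)

theorem plus_comm' (a b : Free k Ω X) : a + b = b + a := by
  revert a b
  refine ind fun a => ind fun b => ?_
  exact sound (Rel.plus_comm a b)

theorem distrib' (a b c : Free k Ω X) : a * (b + c) = a * b + a * c := by
  revert a b c
  refine ind fun a => ind fun b => ind fun c => ?_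
  exact sound (Rel.distrib a b c)

theorem one_times' (a : Free k Ω X) : 1 * a = a := by
  revert a
  exact ind fun a => sound (Rel.one_times a)

theorem zero_times' (a : Free k Ω X) : 0 * a = 0 := by
  revert a
  exact ind fun a => sound (Rel.zero_times a)

theorem zero_plus' (a : Free k Ω X) : 0 + a = a := by
  revert a
  exact ind fun a => sound (Rel.zero_plus a)

instance : CommRing (Free k Ω X) where
  add_assoc := ind fun a => ind fun b => ind fun c => sound (Rel.plus_assoc a b c)
  zero_add := zero_plus'
  add_zero a := by rw [plus_comm', zero_plus']
  add_comm := plus_comm'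
  mul_assoc := ind fun a => ind fun b => ind fun c => sound (Rel.times_assoc a b c)
  one_mul := one_times'
  mul_one a := by rw [times_comm', one_times']
  mul_comm := times_comm'
  left_distrib := distrib'
  right_distrib a b c := by rw [times_comm', distrib', times_comm' c a, times_comm' c b]
  zero_mul := zero_times'
  mul_zero a := by rw [times_comm', zero_times']
  neg_add_cancel := ind fun a => sound (Rel.neg_plus a)
  nsmul := nsmulRec
  zsmul := zsmulRec

/-- The structure map. -/
def ofConst : k →+* Free k Ω X where
  toFun r := mk (const r)
  map_zero' := rfl
  map_one' := rfl
  map_add' r s := sound (Rel.const_plus r s)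
  map_mul' r s := sound (Rel.const_times r s)

instance : Algebra k (Free k Ω X) := ofConst.toAlgebra

theorem smul_mk (r : k) (a : Pre k Ω X) : r • mk a = mk (times (const r) a) := rfl

/-- The operators. -/
def opLin (o : Ω) : Free k Ω X →ₗ[k] Free k Ω X where
  toFun := Quotient.map (op o) fun _ _ h => Rel.op_congr o h
  map_add' := ind fun a => ind fun b => sound (Rel.op_plus o a b)
  map_smul' r := ind fun a => sound (Rel.op_smul o r a)

theorem opLin_rb (o p : Ω) : ∀ (a b : Free k Ω X),
    opLin o a * opLin p b = opLin o (a * opLin p b) + opLin p (opLin o a * b) :=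
  ind fun a => ind fun b => sound (Rel.rb o p a b)

/-- The free object. -/
def obj (k : Type u) [CommRing k] (Ω : Type v) (X : Type w) :
    CommMatchingRB.{u, v, max u v w} k Ω where
  carrier := Free k Ω X
  P := opLin
  rb := opLin_rb

/-- Evaluation of terms. -/
def ev (R : CommMatchingRB.{u, v, x} k Ω) (f : X → R.carrier) : Pre k Ω X → R.carrier
  | var a => f a
  | const r => algebraMap k R.carrier r
  | plus a b => ev R f a + ev R f b
  | times a b => ev R f a * ev R f b
  | op o a => R.P o (ev R f a)

theorem ev_rel (R : CommMatchingRB.{u, v, x} k Ω) (f : X → R.carrier) {a b : Pre k Ω X}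
    (h : Rel k Ω X a b) : ev R f a = ev R f b := by
  induction h with
  | refl => rfl
  | symm _ ih => exact ih.symm
  | trans _ _ h1 h2 => exact h1.trans h2
  | plus_congr _ _ h1 h2 => simp only [ev, h1, h2]
  | times_congr _ _ h1 h2 => simp only [ev, h1, h2]
  | op_congr _ _ h1 => simp only [ev, h1]
  | op_smul o r a => simp only [ev, ← Algebra.smul_def, map_smul]
  | op_plus o a b => simp only [ev, map_add]
  | rb o p a b => exact R.rb o p _ _
  | _ => simp only [ev, map_add, map_mul, map_zero, map_one, map_neg]; try ring

/-- The induced homomorphism. -/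
def lift (R : CommMatchingRB.{u, v, x} k Ω) (f : X → R.carrier) :
    Free k Ω X →ₐ[k] R.carrier where
  toFun := Quotient.lift (ev R f) fun _ _ h => ev_rel R f h
  map_zero' := map_zero (algebraMap k R.carrier)
  map_one' := map_one (algebraMap k R.carrier)
  map_add' := ind fun _ => ind fun _ => rfl
  map_mul' := ind fun _ => ind fun _ => rfl
  commutes' _ := rfl

theorem lift_unique (R : CommMatchingRB.{u, v, x} k Ω) (f : X → R.carrier)
    (g : Free k Ω X →ₐ[k] R.carrier) (hP : ∀ o z, g (opLin o z) = R.P o (g z))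
    (hj : ∀ a, g (mk (var a)) = f a) (t : Pre k Ω X) : g (mk t) = ev R f t := by
  induction t with
  | var a => exact hj a
  | const r => exact g.commutes r
  | plus a b ha hb => exact (map_add g (mk a) (mk b)).trans (by rw [ha, hb]; rfl)
  | times a b ha hb => exact (map_mul g (mk a) (mk b)).trans (by rw [ha, hb]; rfl)
  | op o a ha => exact (hP o (mk a)).trans (by rw [ha]; rfl)

end

end FreeRB

/-- Existence of the free commutative matching Rota-Baxter algebra of weight zero on a
set `X`. -/
theorem free_comm_matching_rb_on_set
    (k : Type u) [CommRing k] (Ω : Type v) [Nonempty Ω] (X : Type w) :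
    ∃ (F : CommMatchingRB.{u, v, max u v w} k Ω) (j : X → F.carrier),
      ∀ (R : CommMatchingRB.{u, v, x} k Ω) (f : X → R.carrier),
        ∃! g : F.carrier →ₐ[k] R.carrier,
          (∀ (ω : Ω) (z : F.carrier), g (F.P ω z) = R.P ω (g z)) ∧
          ∀ a : X, g (j a) = f a := by
  refine ⟨FreeRB.obj k Ω X, fun a => FreeRB.mk (FreeRB.Pre.var a), fun R f => ?_⟩
  refine ⟨FreeRB.lift R f, ⟨fun ω => FreeRB.ind fun a => rfl, fun a => rfl⟩, ?_⟩
  rintro g ⟨hP, hj⟩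
  refine AlgHom.ext (FreeRB.ind fun t => ?_)
  exact FreeRB.lift_unique R f g hP hj t
end

section
/- Let k be a commutative ring, Ω a nonempty set, and D a k-module with families of bilinear operations (≺_ω)_{ω∈Ω} and (≻_ω)_{ω∈Ω} forming a matching dendriform algebra. For any finitely supported family of scalars (a_ω)_{ω∈Ω} in k, the operations x ≺ y := Σ_ω a_ω (x ≺_ω y) and x ≻ y := Σ_ω a_ω (x ≻_ω y) make (D, ≺, ≻) a dendriform algebra: (x≺y)≺z = x≺(y≺z) + x≺(y≻z), (x≻y)≺z = x≻(y≺z), and (x≺y)≻z + (x≻y)≻z = x≻(y≻z) for all x, y, z ∈ D. -/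
/-- A finitely supported linear combination of the operations of a matching dendriform
algebra is a dendriform algebra. -/
theorem matching_dendriform_linear_combination
    (k : Type*) [CommRing k] (Ω : Type*) [Nonempty Ω]
    (D : Type*) [AddCommGroup D] [Module k D]
    (pre suc : Ω → D →ₗ[k] D →ₗ[k] D)
    (h1 : ∀ (α β : Ω) (x y z : D),
      pre β (pre α x y) z = pre α x (pre β y z) + pre β x (suc α y z))
    (h2 : ∀ (α β : Ω) (x y z : D),
      pre β (suc α x y) z = suc α x (pre β y z))
    (h3 : ∀ (α β : Ω) (x y z : D),
      suc α (pre β x y) z + suc β (suc α x y) z = suc α x (suc β y z))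
    (a : Ω →₀ k) (l r : D → D → D)
    (hl : ∀ x y, l x y = ∑ ω ∈ a.support, a ω • pre ω x y)
    (hr : ∀ x y, r x y = ∑ ω ∈ a.support, a ω • suc ω x y) :
    (∀ x y z : D, l (l x y) z = l x (l y z) + l x (r y z)) ∧
    (∀ x y z : D, l (r x y) z = r x (l y z)) ∧
    (∀ x y z : D, r (l x y) z + r (r x y) z = r x (r y z)) := by
  have L : ∀ (P Q : Ω → D →ₗ[k] D →ₗ[k] D) (x y z : D),
      ∑ β ∈ a.support, a β • P β (∑ α ∈ a.support, a α • Q α x y) z =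
        ∑ β ∈ a.support, ∑ α ∈ a.support, (a β * a α) • P β (Q α x y) z := by
    intro P Q x y z
    simp only [map_sum, map_smul, LinearMap.sum_apply, LinearMap.smul_apply,
      Finset.smul_sum, smul_smul]
  have R : ∀ (P Q : Ω → D →ₗ[k] D →ₗ[k] D) (x y z : D),
      ∑ β ∈ a.support, a β • P β x (∑ α ∈ a.support, a α • Q α y z) =
        ∑ β ∈ a.support, ∑ α ∈ a.support, (a β * a α) • P β x (Q α y z) := by
    intro P Q x y z
    simp only [map_sum, map_smul, Finset.smul_sum, smul_smul]
  refine ⟨fun x y z => ?_, fun x y z => ?_, fun x y z => ?_⟩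
  · simp only [hl, hr]
    rw [L, R, R, Finset.sum_comm (f := fun β α => (a β * a α) • pre β x (pre α y z))]
    simp only [← Finset.sum_add_distrib]
    refine Finset.sum_congr rfl fun β _ => Finset.sum_congr rfl fun α _ => ?_
    rw [h1, smul_add, mul_comm (a α)]
  · simp only [hl, hr]
    rw [L, R, Finset.sum_comm]
    refine Finset.sum_congr rfl fun β _ => Finset.sum_congr rfl fun α _ => ?_
    rw [h2, mul_comm]
  · simp only [hl, hr]
    rw [L, L, R, Finset.sum_comm (f := fun β α => (a β * a α) • suc β (suc α x y) z)]
    simp only [← Finset.sum_add_distrib]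
    refine Finset.sum_congr rfl fun α _ => Finset.sum_congr rfl fun β _ => ?_
    rw [← h3, smul_add, mul_comm (a β)]
end

section
/- Let k be a commutative ring, Ω a nonempty set, λ : Ω → k, and (R, (P_ω)_{ω∈Ω}) a matching Rota-Baxter k-algebra of weight λ. Define bilinear operations x ≺_ω y := x P_ω(y) + λ_ω xy and x ≻_ω y := P_ω(x) y for ω ∈ Ω. Then (R, (≺_ω, ≻_ω)_{ω∈Ω}) is a matching dendriform algebra: for all x, y, z ∈ R and α, β ∈ Ω, (x≺_α y)≺_β z = x≺_α(y≺_β z) + x≺_β(y≻_α z); (x≻_α y)≺_β z = x≻_α(y≺_β z); and (x≺_β y)≻_α z + (x≻_α y)≻_β z = x≻_α(y≻_β z). -/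
/-- A matching Rota-Baxter algebra of weight `lam` induces a matching dendriform algebra
via `x ≺_ω y := x P_ω(y) + lam ω • (x y)` and `x ≻_ω y := P_ω(x) y`. -/
theorem matching_rb_to_matching_dendriform
    (k : Type*) [CommRing k] (Ω : Type*) [Nonempty Ω] (lam : Ω → k)
    (R : Type*) [Ring R] [Algebra k R] (P : Ω → R →ₗ[k] R)
    (hP : ∀ (α β : Ω) (x y : R),
      P α x * P β y = P α (x * P β y) + P β (P α x * y) + lam β • P α (x * y))
    (pre suc : Ω → R → R → R)
    (hpre : ∀ (ω : Ω) (x y : R), pre ω x y = x * P ω y + lam ω • (x * y))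
    (hsuc : ∀ (ω : Ω) (x y : R), suc ω x y = P ω x * y) :
    (∀ (α β : Ω) (x y z : R),
      pre β (pre α x y) z = pre α x (pre β y z) + pre β x (suc α y z)) ∧
    (∀ (α β : Ω) (x y z : R),
      pre β (suc α x y) z = suc α x (pre β y z)) ∧
    (∀ (α β : Ω) (x y z : R),
      suc α (pre β x y) z + suc β (suc α x y) z = suc α x (suc β y z)) := by
  refine ⟨fun α β x y z => ?_, fun α β x y z => ?_, fun α β x y z => ?_⟩
  · have h := congrArg (fun t => x * t) (hP α β y z)
    simp only [mul_add, mul_smul_comm] at h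
    simp only [hpre, hsuc, map_add, map_smul, mul_add, add_mul, smul_add, mul_smul_comm,
      smul_mul_assoc, mul_assoc, h, smul_comm (lam β) (lam α)]
    abel
  · simp only [hpre, hsuc, mul_add, mul_smul_comm, mul_assoc]
  · simp only [hpre, hsuc]
    rw [← mul_assoc, hP α β x y, map_add, map_smul]
    simp only [add_mul]
    abel
end

section
/- Let k be a commutative ring, Ω a nonempty set, and (Z, (∘_ω)_{ω∈Ω}) a matching Zinbiel algebra. Define x ≺_ω y := x ∘_ω y and x ≻_ω y := y ∘_ω x for x, y ∈ Z and ω ∈ Ω. Then (Z, (≺_ω, ≻_ω)_{ω∈Ω}) is a commutative matching dendriform algebra: for all x, y, z ∈ Z and α, β ∈ Ω, x ≻_ω y = y ≺_ω x, (x≺_α y)≺_β z = x≺_α(y≺_β z) + x≺_β(y≻_α z), (x≻_α y)≺_β z = x≻_α(y≺_β z), and (x≺_β y)≻_α z + (x≻_α y)≻_β z = x≻_α(y≻_β z). -/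
/-- A matching Zinbiel algebra gives a commutative matching dendriform algebra via
`x ≺_ω y := x ∘_ω y` and `x ≻_ω y := y ∘_ω x`. -/
theorem matching_zinbiel_to_comm_matching_dendriform
    (k : Type*) [CommRing k] (Ω : Type*) [Nonempty Ω]
    (Z : Type*) [AddCommGroup Z] [Module k Z]
    (circ : Ω → Z →ₗ[k] Z →ₗ[k] Z)
    (hz : ∀ (α β : Ω) (x y z : Z),
      circ β (circ α x y) z = circ α x (circ β y z) + circ β x (circ α z y))
    (pre suc : Ω → Z → Z → Z)
    (hpre : ∀ (ω : Ω) (x y : Z), pre ω x y = circ ω x y)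
    (hsuc : ∀ (ω : Ω) (x y : Z), suc ω x y = circ ω y x) :
    (∀ (ω : Ω) (x y : Z), suc ω x y = pre ω y x) ∧
    (∀ (α β : Ω) (x y z : Z),
      pre β (pre α x y) z = pre α x (pre β y z) + pre β x (suc α y z)) ∧
    (∀ (α β : Ω) (x y z : Z),
      pre β (suc α x y) z = suc α x (pre β y z)) ∧
    (∀ (α β : Ω) (x y z : Z),
      suc α (pre β x y) z + suc β (suc α x y) z = suc α x (suc β y z)) := by
  refine ⟨fun ω x y => ?_, fun α β x y z => ?_, fun α β x y z => ?_, fun α β x y z => ?_⟩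
  · rw [hsuc, hpre]
  · simp only [hpre, hsuc]
    exact hz α β x y z
  · simp only [hpre, hsuc]
    rw [hz α β y x z, hz β α y z x, add_comm]
  · simp only [hpre, hsuc]
    rw [hz β α z y x, add_comm]
end

section
/- Let k be a commutative ring, Ω and I nonempty sets, and for each i ∈ I let A_i = (a_{i,ω})_{ω∈Ω} be a finitely supported family of scalars in k. Let (Z, (∘_ω)_{ω∈Ω}) be a matching Zinbiel algebra. Define x ∘_i y := Σ_{ω∈Ω} a_{i,ω} (x ∘_ω y) for i ∈ I. Then (Z, (∘_i)_{i∈I}) is a matching Zinbiel algebra: for all x, y, z ∈ Z and i, j ∈ I, (x ∘_i y) ∘_j z = x ∘_i (y ∘_j z) + x ∘_j (z ∘_i y). In particular, (Z, ∘_i) is a Zinbiel algebra for each i ∈ I. -/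
/-- Finitely supported linear combinations of the operations of a matching Zinbiel algebra
again form a matching Zinbiel algebra. -/
theorem matching_zinbiel_linear_combinations
    (k : Type*) [CommRing k] (Ω : Type*) [Nonempty Ω] (I : Type*) [Nonempty I]
    (a : I → Ω →₀ k)
    (Z : Type*) [AddCommGroup Z] [Module k Z]
    (circ : Ω → Z →ₗ[k] Z →ₗ[k] Z)
    (hz : ∀ (α β : Ω) (x y z : Z),
      circ β (circ α x y) z = circ α x (circ β y z) + circ β x (circ α z y))
    (op : I → Z → Z → Z)
    (hop : ∀ (i : I) (x y : Z), op i x y = ∑ ω ∈ (a i).support, a i ω • circ ω x y)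
    (i j : I) (x y z : Z) :
    op j (op i x y) z = op i x (op j y z) + op j x (op i z y) := by
  simp only [hop, map_sum, map_smul, LinearMap.sum_apply, LinearMap.smul_apply, hz, smul_add,
    Finset.smul_sum, Finset.sum_add_distrib]
  congr 1
  rw [Finset.sum_comm]
  exact Finset.sum_congr rfl fun α _ => Finset.sum_congr rfl fun β _ => smul_comm _ _ _
end

section
/- Let Ω be a nonempty set and let (k_ω)_{ω∈Ω} be a family of continuous real-valued functions on ℝ. On the algebra of continuous functions f : ℝ → ℝ, define f ∘_ω g to be the function x ↦ f(x) · ∫_0^x k_ω(t) g(t) dt. Then these operations satisfy the matching Zinbiel identity: for all continuous f, g, h : ℝ → ℝ, all α, β ∈ Ω, and all x ∈ ℝ, ((f ∘_α g) ∘_β h)(x) = (f ∘_α (g ∘_β h))(x) + (f ∘_β (h ∘_α g))(x). -/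
/-- The operations `f ∘_ω g := f · ∫_0^x k_ω g` on continuous functions satisfy the
matching Zinbiel identity. -/
theorem volterra_matching_zinbiel
    (Ω : Type*) [Nonempty Ω] (k : Ω → ℝ → ℝ) (hk : ∀ ω, Continuous (k ω))
    (circ : Ω → (ℝ → ℝ) → (ℝ → ℝ) → (ℝ → ℝ))
    (hcirc : ∀ (ω : Ω) (f g : ℝ → ℝ) (x : ℝ),
      circ ω f g x = f x * ∫ t in (0:ℝ)..x, k ω t * g t)
    (f g h : ℝ → ℝ) (hf : Continuous f) (hg : Continuous g) (hh : Continuous h)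
    (α β : Ω) (x : ℝ) :
    circ β (circ α f g) h x = circ α f (circ β g h) x + circ β f (circ α h g) x := by
  have ha : Continuous (fun t => k α t * g t) := (hk α).mul hg
  have hb : Continuous (fun t => k β t * h t) := (hk β).mul hh
  have key := intervalIntegral.integral_mul_deriv_eq_deriv_mul (a := 0) (b := x)
    (u := fun y => ∫ t in (0:ℝ)..y, k α t * g t) (v := fun y => ∫ t in (0:ℝ)..y, k β t * h t)
    (fun y _ => ha.integral_hasStrictDerivAt 0 y |>.hasDerivAt)
    (fun y _ => hb.integral_hasStrictDerivAt 0 y |>.hasDerivAt)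
    (ha.intervalIntegrable 0 x) (hb.intervalIntegrable 0 x)
  simp only [intervalIntegral.integral_same, mul_zero, sub_zero] at key
  have e1 : ∫ t in (0:ℝ)..x, k α t * circ β g h t
      = ∫ t in (0:ℝ)..x, (k α t * g t) * ∫ s in (0:ℝ)..t, k β s * h s := by
    congr 1
    funext t
    rw [hcirc, mul_assoc]
  have e2 : ∫ t in (0:ℝ)..x, k β t * circ α h g t
      = ∫ t in (0:ℝ)..x, (∫ s in (0:ℝ)..t, k α s * g s) * (k β t * h t) := by
    congr 1
    funext t
    rw [hcirc]
    ring
  rw [hcirc β, hcirc α f g, hcirc α f, hcirc β f, e1, e2, key]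
  ring
end

section
/- Let k be a commutative ring, Ω a nonempty set, and M a k-module. Then there exists a free matching Zinbiel algebra on M; that is, there exist a k-module Z with a family of bilinear operations (∘_ω)_{ω∈Ω} satisfying the matching Zinbiel identity (x∘_α y)∘_β z = x∘_α(y∘_β z) + x∘_β(z∘_α y) for all x, y, z ∈ Z and α, β ∈ Ω, and a k-linear map j : M → Z, such that for every k-module D with bilinear operations (•_ω)_{ω∈Ω} satisfying the same matching Zinbiel identity and every k-linear map f : M → D, there is a unique k-linear map f̄ : Z → D with f̄(x ∘_ω y) = f̄(x) •_ω f̄(y) for all x, y ∈ Z and ω ∈ Ω, and f̄ ∘ j = f. -/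
universe u v w x

/-- A matching Zinbiel algebra over `k` with operation set `Ω`. -/
structure MatchingZinbiel (k : Type u) [CommRing k] (Ω : Type v) :
    Type (max u v (w + 1)) where
  carrier : Type w
  [instAddCommGroup : AddCommGroup carrier]
  [instModule : Module k carrier]
  circ : Ω → carrier →ₗ[k] carrier →ₗ[k] carrier
  zinbiel : ∀ (α β : Ω) (a b c : carrier),
    circ β (circ α a b) c = circ α a (circ β b c) + circ β a (circ α c b)

attribute [instance] MatchingZinbiel.instAddCommGroup MatchingZinbiel.instModule

namespace FreeMZ

section

variable (k : Type u) [CommRing k] (Ω : Type v) (M : Type w) [AddCommGroup M] [Module k M]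

/-- Formal terms. -/
inductive Pre : Type (max u v w)
  | of : M → Pre
  | zero : Pre
  | plus : Pre → Pre → Pre
  | smul : k → Pre → Pre
  | mul : Ω → Pre → Pre → Pre

variable {k Ω M}

/-- The congruence generated by the module axioms, bilinearity, the matching Zinbiel identity and
linearity of the inclusion of `M`. -/
inductive Rel : Pre k Ω M → Pre k Ω M → Prop
  | refl (a) : Rel a a
  | symm {a b} : Rel a b → Rel b a
  | trans {a b c} : Rel a b → Rel b c → Rel a c
  | plus_congr {a a' b b'} : Rel a a' → Rel b b' → Rel (.plus a b) (.plus a' b')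
  | smul_congr (r : k) {a a'} : Rel a a' → Rel (.smul r a) (.smul r a')
  | mul_congr (ω : Ω) {a a' b b'} : Rel a a' → Rel b b' → Rel (.mul ω a b) (.mul ω a' b')
  | plus_assoc (a b c) : Rel (.plus (.plus a b) c) (.plus a (.plus b c))
  | plus_comm (a b) : Rel (.plus a b) (.plus b a)
  | zero_plus (a) : Rel (.plus .zero a) a
  | one_smul (a) : Rel (.smul 1 a) a
  | mul_smul (r s : k) (a) : Rel (.smul (r * s) a) (.smul r (.smul s a))
  | smul_plus (r : k) (a b) : Rel (.smul r (.plus a b)) (.plus (.smul r a) (.smul r b))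
  | plus_smul (r s : k) (a) : Rel (.smul (r + s) a) (.plus (.smul r a) (.smul s a))
  | zero_smul (a) : Rel (.smul 0 a) .zero
  | smul_zero (r : k) : Rel (.smul r .zero) .zero
  | plus_mul (ω : Ω) (a b c) : Rel (.mul ω (.plus a b) c) (.plus (.mul ω a c) (.mul ω b c))
  | mul_plus (ω : Ω) (a b c) : Rel (.mul ω a (.plus b c)) (.plus (.mul ω a b) (.mul ω a c))
  | smul_mul (ω : Ω) (r : k) (a b) : Rel (.mul ω (.smul r a) b) (.smul r (.mul ω a b))
  | mul_smul' (ω : Ω) (r : k) (a b) : Rel (.mul ω a (.smul r b)) (.smul r (.mul ω a b))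
  | zin (α β : Ω) (a b c) : Rel (.mul β (.mul α a b) c)
      (.plus (.mul α a (.mul β b c)) (.mul β a (.mul α c b)))
  | of_plus (m n : M) : Rel (.of (m + n)) (.plus (.of m) (.of n))
  | of_smul (r : k) (m : M) : Rel (.of (r • m)) (.smul r (.of m))

variable (k Ω M)

/-- The setoid of `Rel`. -/
def setoid : Setoid (Pre k Ω M) := ⟨Rel, .refl, .symm, .trans⟩

/-- The carrier of the free matching Zinbiel algebra. -/
def Carrier : Type (max u v w) := Quotient (setoid k Ω M)

variable {k Ω M}

/-- The class of a term. -/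
def mk (a : Pre k Ω M) : Carrier k Ω M := Quotient.mk (setoid k Ω M) a

theorem mk_eq {a b : Pre k Ω M} (h : Rel a b) : mk a = mk b := Quotient.sound h

theorem mk_surj (z : Carrier k Ω M) : ∃ a, mk a = z := Quotient.exists_rep z

instance : Zero (Carrier k Ω M) := ⟨mk .zero⟩
instance : Add (Carrier k Ω M) :=
  ⟨Quotient.map₂ Pre.plus (fun _ _ h _ _ h' => Rel.plus_congr h h')⟩
instance : SMul k (Carrier k Ω M) :=
  ⟨fun r => Quotient.map (Pre.smul r) (fun _ _ h => Rel.smul_congr r h)⟩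

/-- The product. -/
def mul (ω : Ω) : Carrier k Ω M → Carrier k Ω M → Carrier k Ω M :=
  Quotient.map₂ (Pre.mul ω) (fun _ _ h _ _ h' => Rel.mul_congr ω h h')

theorem zero_def : (0 : Carrier k Ω M) = mk .zero := rfl
theorem mk_plus (a b : Pre k Ω M) : mk a + mk b = mk (.plus a b) := rfl
theorem mk_smul (r : k) (a : Pre k Ω M) : r • mk a = mk (.smul r a) := rfl
theorem mk_mul (ω : Ω) (a b : Pre k Ω M) : mul ω (mk a) (mk b) = mk (.mul ω a b) := rfl

instance instACM : AddCommMonoid (Carrier k Ω M) where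
  add_assoc a b c := by
    obtain ⟨a, rfl⟩ := mk_surj a
    obtain ⟨b, rfl⟩ := mk_surj b
    obtain ⟨c, rfl⟩ := mk_surj c
    exact mk_eq (.plus_assoc a b c)
  zero_add a := by
    obtain ⟨a, rfl⟩ := mk_surj a
    exact mk_eq (.zero_plus a)
  add_zero a := by
    obtain ⟨a, rfl⟩ := mk_surj a
    exact mk_eq (.trans (.plus_comm _ _) (.zero_plus a))
  add_comm a b := by
    obtain ⟨a, rfl⟩ := mk_surj a
    obtain ⟨b, rfl⟩ := mk_surj b
    exact mk_eq (.plus_comm a b)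
  nsmul := nsmulRec

instance instMod : Module k (Carrier k Ω M) where
  one_smul a := by
    obtain ⟨a, rfl⟩ := mk_surj a
    exact mk_eq (.one_smul a)
  mul_smul r s a := by
    obtain ⟨a, rfl⟩ := mk_surj a
    exact mk_eq (.mul_smul r s a)
  smul_zero r := mk_eq (.smul_zero r)
  smul_add r a b := by
    obtain ⟨a, rfl⟩ := mk_surj a
    obtain ⟨b, rfl⟩ := mk_surj b
    exact mk_eq (.smul_plus r a b)
  add_smul r s a := by
    obtain ⟨a, rfl⟩ := mk_surj a
    exact mk_eq (.plus_smul r s a)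
  zero_smul a := by
    obtain ⟨a, rfl⟩ := mk_surj a
    exact mk_eq (.zero_smul a)

instance : Neg (Carrier k Ω M) := ⟨fun a => (-1 : k) • a⟩

instance instACG : AddCommGroup (Carrier k Ω M) :=
  { instACM with
    zsmul := zsmulRec
    neg_add_cancel := fun a => by
      change (-1 : k) • a + a = 0
      conv_lhs => rw [← _root_.one_smul k a]
      rw [smul_smul, ← add_smul]
      simp }

variable (k Ω M) in
/-- The free matching Zinbiel algebra. -/
def free : MatchingZinbiel.{u, v, max u v w} k Ω where
  carrier := Carrier k Ω M
  circ ω := LinearMap.mk₂ k (mul ω)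
    (fun a b c => by
      obtain ⟨a, rfl⟩ := mk_surj a
      obtain ⟨b, rfl⟩ := mk_surj b
      obtain ⟨c, rfl⟩ := mk_surj c
      exact mk_eq (.plus_mul ω a b c))
    (fun r a b => by
      obtain ⟨a, rfl⟩ := mk_surj a
      obtain ⟨b, rfl⟩ := mk_surj b
      exact mk_eq (.smul_mul ω r a b))
    (fun a b c => by
      obtain ⟨a, rfl⟩ := mk_surj a
      obtain ⟨b, rfl⟩ := mk_surj b
      obtain ⟨c, rfl⟩ := mk_surj c
      exact mk_eq (.mul_plus ω a b c))
    (fun r a b => by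
      obtain ⟨a, rfl⟩ := mk_surj a
      obtain ⟨b, rfl⟩ := mk_surj b
      exact mk_eq (.mul_smul' ω r a b))
  zinbiel α β a b c := by
    obtain ⟨a, rfl⟩ := mk_surj a
    obtain ⟨b, rfl⟩ := mk_surj b
    obtain ⟨c, rfl⟩ := mk_surj c
    exact mk_eq (.zin α β a b c)

variable (k Ω M) in
/-- The inclusion of `M`. -/
def incl : M →ₗ[k] Carrier k Ω M where
  toFun m := mk (.of m)
  map_add' m n := mk_eq (.of_plus m n)
  map_smul' r m := mk_eq (.of_smul r m)

variable (D : MatchingZinbiel.{u, v, x} k Ω) (f : M →ₗ[k] D.carrier)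

/-- Evaluation of terms. -/
def eval : Pre k Ω M → D.carrier
  | .of m => f m
  | .zero => 0
  | .plus a b => eval a + eval b
  | .smul r a => r • eval a
  | .mul ω a b => D.circ ω (eval a) (eval b)

theorem eval_rel {a b : Pre k Ω M} (h : Rel a b) : eval D f a = eval D f b := by
  induction h with
  | refl => rfl
  | symm _ ih => exact ih.symm
  | trans _ _ ih ih' => exact ih.trans ih'
  | plus_congr _ _ ih ih' => simp only [eval, ih, ih']
  | smul_congr _ _ ih => simp only [eval, ih]
  | mul_congr _ _ _ ih ih' => simp only [eval, ih, ih']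
  | plus_assoc => exact add_assoc _ _ _
  | plus_comm => exact add_comm _ _
  | mul_smul => exact (smul_smul _ _ _).symm
  | plus_smul => exact add_smul _ _ _
  | zin => exact D.zinbiel _ _ _ _ _
  | _ => simp [eval]

/-- The induced homomorphism. -/
def lift : Carrier k Ω M →ₗ[k] D.carrier where
  toFun := Quotient.lift (eval D f) (fun _ _ h => eval_rel D f h)
  map_add' a b := by
    obtain ⟨a, rfl⟩ := mk_surj a
    obtain ⟨b, rfl⟩ := mk_surj b
    rfl
  map_smul' r a := by
    obtain ⟨a, rfl⟩ := mk_surj a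
    rfl

end

end FreeMZ

/-- Existence of the free matching Zinbiel algebra on a module `M`. -/
theorem free_matching_zinbiel
    (k : Type u) [CommRing k] (Ω : Type v) [Nonempty Ω]
    (M : Type w) [AddCommGroup M] [Module k M] :
    ∃ (Z : MatchingZinbiel.{u, v, max u v w} k Ω) (j : M →ₗ[k] Z.carrier),
      ∀ (D : MatchingZinbiel.{u, v, x} k Ω) (f : M →ₗ[k] D.carrier),
        ∃! g : Z.carrier →ₗ[k] D.carrier,
          (∀ (ω : Ω) (a b : Z.carrier), g (Z.circ ω a b) = D.circ ω (g a) (g b)) ∧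
          ∀ m : M, g (j m) = f m := by
  refine ⟨FreeMZ.free k Ω M, FreeMZ.incl k Ω M, fun D f => ⟨FreeMZ.lift D f, ⟨?_, ?_⟩, ?_⟩⟩
  · intro ω a b
    obtain ⟨a, rfl⟩ := FreeMZ.mk_surj a
    obtain ⟨b, rfl⟩ := FreeMZ.mk_surj b
    rfl
  · intro m
    rfl
  · rintro (g : FreeMZ.Carrier k Ω M →ₗ[k] D.carrier) ⟨hg, hj⟩
    refine LinearMap.ext fun z => ?_
    obtain ⟨a, rfl⟩ := FreeMZ.mk_surj z
    change g (FreeMZ.mk a) = FreeMZ.eval D f a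
    induction a with
    | of m => exact hj m
    | zero => exact map_zero g
    | plus a b iha ihb => exact (map_add g (FreeMZ.mk a) (FreeMZ.mk b)).trans (by rw [iha, ihb]; rfl)
    | smul r a iha => exact (map_smul g r (FreeMZ.mk a)).trans (by rw [iha]; rfl)
    | mul ω a b iha ihb =>
      refine (hg ω (FreeMZ.mk a) (FreeMZ.mk b)).trans ?_
      change D.circ ω (g (FreeMZ.mk a)) (g (FreeMZ.mk b)) = _
      rw [iha, ihb]; rfl
end

section
/- Let Ω be a nonempty set and let (k_ω)_{ω∈Ω} be a family of continuous real-valued functions on ℝ, with Volterra operators I_ω(f)(x) := ∫_0^x k_ω(t) f(t) dt on continuous functions. Define f ≺_ω g := f · I_ω(g) and f ≻_ω g := g · I_ω(f) (pointwise products). Then these operations satisfy the matching dendriform axioms: for all continuous f, g, h : ℝ → ℝ and all α, β ∈ Ω, (f≺_α g)≺_β h = f≺_α(g≺_β h) + f≺_β(g≻_α h); (f≻_α g)≺_β h = f≻_α(g≺_β h); and (f≺_β g)≻_α h + (f≻_α g)≻_β h = f≻_α(g≻_β h), where all identities are equalities of functions on ℝ. -/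
/-- Integration by parts for two primitives based at `0`. -/
lemma volterra_aux (u v : ℝ → ℝ) (hu : Continuous u) (hv : Continuous v) (x : ℝ) :
    (∫ t in (0:ℝ)..x, u t) * (∫ t in (0:ℝ)..x, v t) =
      (∫ t in (0:ℝ)..x, u t * ∫ s in (0:ℝ)..t, v s) +
        ∫ t in (0:ℝ)..x, v t * ∫ s in (0:ℝ)..t, u s := by
  have h := intervalIntegral.integral_mul_deriv_eq_deriv_mul (a := 0) (b := x)
    (u := fun t => ∫ s in (0:ℝ)..t, u s) (v := fun t => ∫ s in (0:ℝ)..t, v s)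
    (u' := u) (v' := v)
    (fun t _ => hu.integral_hasStrictDerivAt 0 t |>.hasDerivAt)
    (fun t _ => hv.integral_hasStrictDerivAt 0 t |>.hasDerivAt)
    (hu.intervalIntegrable _ _) (hv.intervalIntegrable _ _)
  simp only [intervalIntegral.integral_same, mul_zero, sub_zero] at h
  have e : (∫ t in (0:ℝ)..x, v t * ∫ s in (0:ℝ)..t, u s) =
      ∫ t in (0:ℝ)..x, (∫ s in (0:ℝ)..t, u s) * v t := by
    simp only [mul_comm]
  rw [e, h]
  ring

/-- The Volterra operations `f ≺_ω g := f · I_ω(g)` and `f ≻_ω g := g · I_ω(f)` on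
continuous functions satisfy the matching dendriform axioms. -/
theorem volterra_matching_dendriform
    (Ω : Type*) [Nonempty Ω] (k : Ω → ℝ → ℝ) (hk : ∀ ω, Continuous (k ω))
    (pre suc : Ω → (ℝ → ℝ) → (ℝ → ℝ) → (ℝ → ℝ))
    (hpre : ∀ (ω : Ω) (f g : ℝ → ℝ) (x : ℝ),
      pre ω f g x = f x * ∫ t in (0:ℝ)..x, k ω t * g t)
    (hsuc : ∀ (ω : Ω) (f g : ℝ → ℝ) (x : ℝ),
      suc ω f g x = g x * ∫ t in (0:ℝ)..x, k ω t * f t)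
    (f g h : ℝ → ℝ) (hf : Continuous f) (hg : Continuous g) (hh : Continuous h)
    (α β : Ω) :
    (∀ x : ℝ, pre β (pre α f g) h x = pre α f (pre β g h) x + pre β f (suc α g h) x) ∧
    (∀ x : ℝ, pre β (suc α f g) h x = suc α f (pre β g h) x) ∧
    (∀ x : ℝ, suc α (pre β f g) h x + suc β (suc α f g) h x = suc α f (suc β g h) x) := by
  have A := volterra_aux
  refine ⟨fun x => ?_, fun x => ?_, fun x => ?_⟩
  · have := A (fun t => k α t * g t) (fun t => k β t * h t) ((hk α).mul hg) ((hk β).mul hh) x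
    simp only [hpre, hsuc, ← mul_assoc] at this ⊢
    rw [mul_assoc, this, mul_add]
  · simp only [hpre, hsuc]
    ring
  · have := A (fun t => k α t * f t) (fun t => k β t * g t) ((hk α).mul hf) ((hk β).mul hg) x
    simp only [hpre, hsuc, ← mul_assoc] at this ⊢
    rw [← mul_add, ← this]
    ring
end
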